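/- arXiv:2511.09718 — 2 statements merged into one kernel-verified Lean document; each statement's English description precedes it below -/
import Mathlib

section
/- There exists a residual subset R of C([0,1]) such that for every f ∈ R, writing A = Ω(f) for the common global Milnor, statistical, and physical attractor of f (so A = Λ(f) = A_stat(f) = A_phys(f) = Ω(f)): (i) A is robust with respect to the Hausdorff metric, i.e. for every ε > 0 there is δ > 0 such that every g ∈ C([0,1]) with ‖g − f‖_∞ < δ satisfies d_H(Λ(g), Λ(f)) < ε; (ii) A is not Lyapunov stable; (iii) A contains no dense orbit, i.e. there is no x ∈ A with closure({f^n(x) : n ≥ 0}) = A; and (iv) f has no Palis attractor. -/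
open MeasureTheory Set Filter Topology

noncomputable section

/-- The unit interval `[0,1]` as a subtype of `ℝ`. -/
abbrev I01 : Type := Set.Icc (0:ℝ) 1

/-- Birkhoff average of visits of the orbit of `x` to `U` up to time `n`. -/
def birkhoffAvg {X : Type*} (f : X → X) (U : Set X) (n : ℕ) (x : X) : ℝ :=
  (∑ k ∈ Finset.range n, U.indicator (fun _ => (1:ℝ)) (f^[k] x)) / n

/-- The ω-limit set of `x` under `f`. -/
def omegaLim {X : Type*} [TopologicalSpace X] (f : X → X) (x : X) : Set X :=
  ⋂ n : ℕ, closure {y | ∃ m, n ≤ m ∧ f^[m] x = y}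

/-- The global Milnor attractor: the intersection of all closed sets containing
`ω_f(x)` for `lam`-almost every `x`. -/
def milnorAttr {X : Type*} [TopologicalSpace X] [MeasurableSpace X]
    (lam : Measure X) (f : X → X) : Set X :=
  ⋂₀ {A : Set X | IsClosed A ∧ ∀ᵐ x ∂lam, omegaLim f x ⊆ A}

/-- The statistical attractor: the complement of the union of all open sets visited
with zero average frequency by almost every orbit. -/
def statAttr {X : Type*} [TopologicalSpace X] [MeasurableSpace X]
    (lam : Measure X) (f : X → X) : Set X :=
  univ \ ⋃₀ {U : Set X | IsOpen U ∧
    ∀ᵐ x ∂lam, Tendsto (fun n => birkhoffAvg f U n x) atTop (nhds 0)}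

/-- An open set `U` is essential if for some `ε, δ > 0` and some sequence `k n → ∞`,
the set of points spending average time `> ε` in `U` up to time `k n` has measure `> δ`. -/
def Essential {X : Type*} [MeasurableSpace X] (lam : Measure X)
    (f : X → X) (U : Set X) : Prop :=
  ∃ ε > (0:ℝ), ∃ δ > (0:ℝ), ∃ k : ℕ → ℕ, Tendsto k atTop atTop ∧
    ∀ n, ENNReal.ofReal δ < lam {x | ε < birkhoffAvg f U (k n) x}

/-- The physical attractor: the complement of the union of all non-essential open sets. -/
def physAttr {X : Type*} [TopologicalSpace X] [MeasurableSpace X]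
    (lam : Measure X) (f : X → X) : Set X :=
  univ \ ⋃₀ {U : Set X | IsOpen U ∧ ¬ Essential lam f U}

/-- The non-wandering set of `f`. -/
def nonWandering {X : Type*} [TopologicalSpace X] (f : X → X) : Set X :=
  {x | ∀ U : Set X, IsOpen U → x ∈ U → ∃ n, 1 ≤ n ∧ ((f^[n] '' U) ∩ U).Nonempty}

/-- A Cantor set: nonempty, compact, perfect and totally disconnected. -/
def IsCantorSet {X : Type*} [TopologicalSpace X] (S : Set X) : Prop :=
  S.Nonempty ∧ IsCompact S ∧ Perfect S ∧ IsTotallyDisconnected S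
/-- Lyapunov stability of a set `A`: every open set containing `A` admits an open set
`V ⊇ A` whose points have their whole forward orbit in `U`. -/
def LyapunovStable {X : Type*} [TopologicalSpace X] (f : X → X) (A : Set X) : Prop :=
  ∀ U : Set X, IsOpen U → A ⊆ U →
    ∃ V : Set X, IsOpen V ∧ A ⊆ V ∧ ∀ x ∈ V, ∀ n : ℕ, f^[n] x ∈ U

/-- The (topological) support of a measure: points all of whose open neighborhoods have
positive measure. -/
def measSupport {X : Type*} [TopologicalSpace X] [MeasurableSpace X]
    (μ : Measure X) : Set X :=
  {x | ∀ U : Set X, IsOpen U → x ∈ U → 0 < μ U}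

/-- The empirical measures `(1/n) ∑_{i<n} δ_{f^i x}` converge weakly to `μ`:
integrals of every continuous function converge. -/
def empiricalConv {X : Type*} [TopologicalSpace X] [MeasurableSpace X]
    (f : X → X) (μ : Measure X) (x : X) : Prop :=
  ∀ φ : C(X, ℝ), Tendsto (fun n => (∑ i ∈ Finset.range n, φ (f^[i] x)) / n)
    atTop (nhds (∫ y, φ y ∂μ))

/-- A Palis attractor: a closed invariant set which is the support of an ergodic invariant
probability measure whose weak basin has positive measure. -/
def IsPalisAttractor {X : Type*} [TopologicalSpace X] [MeasurableSpace X]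
    (lam : Measure X) (f : X → X) (A : Set X) : Prop :=
  IsClosed A ∧ f '' A ⊆ A ∧
    ∃ μ : Measure X, IsProbabilityMeasure μ ∧ Ergodic f μ ∧
      measSupport μ = A ∧ 0 < lam {x | empiricalConv f μ x}

theorem exists_perturbation_eq_const {ι : Type*} [Finite ι] (f : C(I01, I01)) {ε : ℝ}
    (K : ι → Set I01) (hK : ∀ i, IsClosed (K i))
    (hdisj : ∀ i j, i ≠ j → Disjoint (K i) (K j)) (t : ι → I01)
    (ht : ∀ i, ∀ x ∈ K i, dist (f x) (t i) ≤ ε) (hε : 0 ≤ ε) :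
    ∃ g : C(I01, I01), dist g f ≤ ε ∧ ∀ i, ∀ x ∈ K i, g x = t i := by
  classical
  have := Fintype.ofFinite ι
  have hu : ∀ i, ∃ u : C(I01, ℝ), (∀ j, j ≠ i → EqOn u 0 (K j)) ∧ EqOn u 1 (K i) := by
    intro i
    obtain ⟨u, h0, h1, -⟩ := exists_continuous_zero_one_of_isClosed
      (s := ⋃ j : {j // j ≠ i}, K j) (t := K i) (isClosed_iUnion_of_finite fun j => hK j) (hK i)
      (disjoint_iUnion_left.2 fun j => hdisj _ _ j.2)
    exact ⟨u, fun j hj x hx => h0 (mem_iUnion.2 ⟨⟨j, hj⟩, hx⟩), h1⟩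
  choose u hu0 hu1 using hu
  let G : I01 → ℝ := fun x => max 0 (min 1 (∑ i, (t i : ℝ) * u i x))
  have hG0 : ∀ x, 0 ≤ G x := fun x => le_max_left _ _
  have hG1 : ∀ x, G x ≤ 1 := fun x => max_le zero_le_one (min_le_left _ _)
  have hGc : Continuous G := by fun_prop
  have hGK : ∀ i, ∀ x ∈ K i, G x = t i := by
    intro i x hx
    have hs : ∑ j, (t j : ℝ) * u j x = t i := by
      rw [Finset.sum_eq_single i]
      · have := hu1 i hx
        simp at this
        simp [this]
      · intro j _ hj
        have := hu0 j i hj.symm hx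
        simp at this
        simp [this]
      · simp
    simp only [G, hs]
    rw [min_eq_right (t i).2.2, max_eq_right (t i).2.1]
  let h : I01 → ℝ := fun x => max (f x - ε) (min (f x + ε) (G x))
  have hh : ∀ x, h x ∈ Icc (0 : ℝ) 1 := by
    intro x
    have h1 := (f x).2
    exact ⟨le_max_of_le_right (le_min (by linarith [h1.1]) (hG0 x)),
      max_le (by linarith [h1.2]) ((min_le_right _ _).trans (hG1 x))⟩
  refine ⟨⟨fun x => ⟨h x, hh x⟩, by fun_prop⟩, ?_, ?_⟩
  · rw [ContinuousMap.dist_le hε]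
    intro x
    rw [Subtype.dist_eq, Real.dist_eq, abs_le]
    constructor
    · have : (f x : ℝ) - ε ≤ h x := le_max_left _ _
      simp only [ContinuousMap.coe_mk]
      linarith
    · have : h x ≤ f x + ε := max_le (by linarith) (min_le_left _ _)
      simp only [ContinuousMap.coe_mk]
      linarith
  · intro i x hx
    have h1 := ht i x hx
    rw [Subtype.dist_eq, Real.dist_eq, abs_le] at h1
    apply Subtype.ext
    change h x = t i
    simp only [h, hGK i x hx]
    rw [min_eq_right (by linarith), max_eq_right (by linarith)]

/-- Maps that send some closed subset of `U` into its (nonempty) interior under an iterate. -/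
def TrapsIn (U : Set I01) : Set C(I01, I01) :=
  {f | ∃ p : ℕ, 1 ≤ p ∧ ∃ K : Set I01, IsClosed K ∧ K.Nonempty ∧ K ⊆ U ∧
    MapsTo (⇑f)^[p] K (interior K)}

theorem exists_continuous_iterate (p : ℕ) :
    ∃ F : C(I01, I01) → C(I01, I01), Continuous F ∧ ∀ f, ⇑(F f) = (⇑f)^[p] := by
  induction p with
  | zero => exact ⟨fun _ => ContinuousMap.id _, continuous_const, fun _ => rfl⟩
  | succ p ih =>
    obtain ⟨F, hF, h⟩ := ih
    refine ⟨fun f => (F f).comp f, hF.compCM continuous_id, fun f => ?_⟩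
    rw [ContinuousMap.coe_comp, h, Function.iterate_succ]

theorem isOpen_trapsIn (U : Set I01) : IsOpen (TrapsIn U) := by
  rw [isOpen_iff_mem_nhds]
  rintro f ⟨p, hp, K, hK, hne, hKU, hf⟩
  obtain ⟨F, hF, h⟩ := exists_continuous_iterate p
  have ho : IsOpen {g : C(I01, I01) | MapsTo (F g) K (interior K)} :=
    (ContinuousMap.isOpen_setOfPred_mapsTo hK.isCompact isOpen_interior).preimage hF
  refine mem_of_superset (ho.mem_nhds ?_) ?_
  · simpa [h] using hf
  · intro g hg
    exact ⟨p, hp, K, hK, hne, hKU, by simpa [h] using hg⟩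

/-- A closing lemma: a nonwandering point can be made an attracting periodic point. -/
theorem mem_closure_trapsIn {f : C(I01, I01)} {U : Set I01} (hU : IsOpen U) {x : I01}
    (hxU : x ∈ U) (hx : x ∈ nonWandering ⇑f) : f ∈ closure (TrapsIn U) := by
  rw [Metric.mem_closure_iff]
  intro ε hε
  obtain ⟨n, hn1, hn⟩ := hx (U ∩ Metric.ball x (ε / 8)) (hU.inter Metric.isOpen_ball)
    ⟨hxU, Metric.mem_ball_self (by positivity)⟩
  set V := U ∩ Metric.ball x (ε / 8) with hV
  have hex : ∃ n, 1 ≤ n ∧ ∃ y ∈ V, (⇑f)^[n] y ∈ V := by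
    obtain ⟨_, ⟨y, hy, rfl⟩, hz⟩ := hn
    exact ⟨n, hn1, y, hy, hz⟩
  classical
  obtain ⟨hm1, y, hyV, hmV⟩ := Nat.find_spec hex
  have hmin := fun k (hk : k < Nat.find hex) => Nat.find_min hex hk
  set m := Nat.find hex with hm
  clear_value m
  have hinj : ∀ i j : Fin m, i < j → (⇑f)^[i] y ≠ (⇑f)^[j] y := by
    intro i j hij he
    have hij' : (i : ℕ) < j := hij
    have hj := j.2
    refine hmin (m - j + i) (by omega) ⟨by omega, y, hyV, ?_⟩
    rw [Function.iterate_add_apply, he, ← Function.iterate_add_apply]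
    rwa [Nat.sub_add_cancel hj.le]
  have hinj' : ∀ i j : Fin m, i ≠ j → (⇑f)^[i] y ≠ (⇑f)^[j] y := by
    intro i j hij
    rcases lt_or_gt_of_ne hij with h | h
    · exact hinj i j h
    · exact (hinj j i h).symm
  have hev : ∀ᶠ r in 𝓝[>] (0 : ℝ), (∀ i j : Fin m, i ≠ j →
      r < dist ((⇑f)^[i] y) ((⇑f)^[j] y) / 2) ∧ Metric.closedBall y r ⊆ U ∧
      ∀ i : Fin m, ∀ z ∈ Metric.closedBall ((⇑f)^[i] y) r,
        dist (f z) (f ((⇑f)^[i] y)) < ε / 4 := by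
    refine Filter.Eventually.and ?_ (Filter.Eventually.and ?_ ?_)
    · refine eventually_all.2 fun i => eventually_all.2 fun j => ?_
      by_cases hij : i = j
      · simp [hij]
      · have : 0 < dist ((⇑f)^[i] y) ((⇑f)^[j] y) / 2 := half_pos (dist_pos.2 (hinj' i j hij))
        filter_upwards [nhdsWithin_le_nhds (Iio_mem_nhds this)] with r hr _ using hr
    · obtain ⟨r, hr, h⟩ := Metric.isOpen_iff.1 hU y hyV.1
      filter_upwards [nhdsWithin_le_nhds (Iio_mem_nhds hr)] with s hs
      exact (Metric.closedBall_subset_ball hs).trans h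
    · refine eventually_all.2 fun i => ?_
      obtain ⟨r, hr, h⟩ := Metric.continuous_iff.1 f.continuous ((⇑f)^[i] y) (ε / 4) (by positivity)
      filter_upwards [nhdsWithin_le_nhds (Iio_mem_nhds hr)] with s hs z hz
      exact h z (lt_of_le_of_lt hz hs)
  obtain ⟨r, ⟨hr1, hr2, hr3⟩, hr0⟩ := (hev.and self_mem_nhdsWithin).exists
  let t : Fin m → I01 := fun i => if (i : ℕ) + 1 = m then y else (⇑f)^[i + 1] y
  have hyd : dist ((⇑f)^[m] y) y ≤ ε / 4 := by
    have h1 := hmV.2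
    have h2 := hyV.2
    rw [Metric.mem_ball] at h1 h2
    linarith [dist_triangle_right ((⇑f)^[m] y) y x]
  obtain ⟨g, hgd, hg⟩ := exists_perturbation_eq_const f (ε := ε / 2)
    (fun i : Fin m => Metric.closedBall ((⇑f)^[i] y) r) (fun i => Metric.isClosed_closedBall)
    (fun i j hij => Metric.closedBall_disjoint_closedBall (by linarith [hr1 i j hij])) t
    (by
      intro i z hz
      have h1 := hr3 i z hz
      rw [← Function.iterate_succ_apply' (⇑f)] at h1
      have h2 : dist ((⇑f)^[i + 1] y) (t i) ≤ ε / 4 := by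
        by_cases hi : (i : ℕ) + 1 = m
        · simp only [t, hi, if_true]
          exact hyd
        · simp only [t, hi, if_false, dist_self]
          positivity
      linarith [dist_triangle (f z) ((⇑f)^[i + 1] y) (t i)]) (by positivity)
  refine ⟨g, ⟨m, hm1, Metric.closedBall y r, Metric.isClosed_closedBall,
    ⟨y, Metric.mem_closedBall_self hr0.le⟩, hr2, ?_⟩, ?_⟩
  · intro z hz
    have hstep : ∀ i, i < m → (⇑g)^[i] z ∈ Metric.closedBall ((⇑f)^[i] y) r := by
      intro i
      induction i with
      | zero => intro _; simpa using hz
      | succ i ih =>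
        intro hi
        have h1 := hg ⟨i, by omega⟩ _ (ih (by omega))
        rw [Function.iterate_succ_apply' (⇑g), h1]
        simp only [t, hi.ne, if_false]
        exact Metric.mem_closedBall_self hr0.le
    obtain ⟨k, rfl⟩ : ∃ k, m = k + 1 := ⟨m - 1, by omega⟩
    have h1 := hg ⟨k, by omega⟩ _ (hstep k (by omega))
    rw [Function.iterate_succ_apply' (⇑g), h1]
    simp only [t, if_true]
    exact Metric.ball_subset_interior_closedBall (Metric.mem_ball_self hr0)
  · rw [dist_comm]
    linarith

theorem disjoint_nonWandering_of_mem_interior_compl {g : C(I01, I01)} {U : Set I01}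
    (hU : IsOpen U) (hg : g ∈ interior (TrapsIn U)ᶜ) : Disjoint U (nonWandering ⇑g) := by
  rw [Set.disjoint_left]
  intro x hx hxg
  rw [interior_compl] at hg
  exact hg (mem_closure_trapsIn hU hx hxg)

theorem tendsto_birkhoffAvg_zero {X : Type*} {f : X → X} {U : Set X} {x : X} {N : ℕ}
    (h : ∀ n, N ≤ n → f^[n] x ∉ U) :
    Tendsto (fun n => birkhoffAvg f U n x) atTop (𝓝 0) := by
  have hc : ∀ᶠ n : ℕ in atTop, (∑ k ∈ Finset.range N, U.indicator (fun _ => (1 : ℝ)) (f^[k] x)) / n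
      = birkhoffAvg f U n x := by
    filter_upwards [eventually_ge_atTop N] with n hn
    rw [birkhoffAvg, ← Finset.sum_range_add_sum_Ico _ hn, Finset.sum_eq_zero (s := Finset.Ico N n),
      add_zero]
    intro k hk
    exact indicator_of_notMem (h k (Finset.mem_Ico.1 hk).1) _
  exact (tendsto_const_div_atTop_nhds_zero_nat _).congr' hc

theorem iterate_mul_mem {X : Type*} {f : X → X} {V : Set X} {p : ℕ} (h : MapsTo f^[p] V V) {x : X}
    (hx : x ∈ V) (n : ℕ) : f^[p * n] x ∈ V := by
  rw [Function.iterate_mul]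
  exact h.iterate n hx

theorem measurable_birkhoffAvg {X : Type*} [MeasurableSpace X] {f : X → X} (hf : Measurable f)
    {U : Set X} (hU : MeasurableSet U) (n : ℕ) : Measurable (birkhoffAvg f U n) := by
  unfold birkhoffAvg
  refine Measurable.div_const (Finset.measurable_sum _ fun k _ => ?_) _
  exact (measurable_const.indicator hU).comp (hf.iterate k)

theorem Essential.mono {X : Type*} [MeasurableSpace X] {lam : Measure X} {f : X → X}
    {U V : Set X} (h : Essential lam f U) (hUV : U ⊆ V) : Essential lam f V := by
  obtain ⟨ε, hε, δ, hδ, k, hk, h⟩ := h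
  refine ⟨ε, hε, δ, hδ, k, hk, fun n => (h n).trans_le (measure_mono fun x hx => ?_)⟩
  refine lt_of_lt_of_le (show ε < birkhoffAvg f U (k n) x from hx) ?_
  unfold birkhoffAvg
  gcongr

theorem essential_of_mapsTo {X : Type*} [MeasurableSpace X] {lam : Measure X} [IsFiniteMeasure lam]
    {f : X → X} {V : Set X} {p : ℕ} (hp : 1 ≤ p) (h : MapsTo f^[p] V V) (hV : 0 < lam V) : Essential lam f V := by
  have hp' : (0 : ℝ) < p := by exact_mod_cast hp
  have hV' : 0 < (lam V).toReal := ENNReal.toReal_pos hV.ne' (measure_ne_top _ _)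
  refine ⟨1 / (2 * p), by positivity, (lam V).toReal / 2, by positivity, fun n => p * (n + 1),
    ?_, fun n => ?_⟩
  · refine tendsto_atTop_mono (fun n => ?_) tendsto_id
    change n ≤ _
    nlinarith
  · have h1 : ENNReal.ofReal ((lam V).toReal / 2) < lam V := by
      rw [ENNReal.ofReal_lt_iff_lt_toReal (by positivity) (measure_ne_top _ _)]
      linarith
    refine h1.trans_le (measure_mono fun x hx => ?_)
    have h2 : ((n : ℝ) + 1) ≤
        ∑ k ∈ Finset.range (p * (n + 1)), V.indicator (fun _ => (1 : ℝ)) (f^[k] x) := by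
      have h3 : ∑ k ∈ (Finset.range (n + 1)).image (p * ·),
          V.indicator (fun _ => (1 : ℝ)) (f^[k] x) = n + 1 := by
        rw [Finset.sum_image fun a _ b _ hab => Nat.eq_of_mul_eq_mul_left hp hab,
          Finset.sum_congr rfl fun k _ => indicator_of_mem (iterate_mul_mem h hx k) _]
        simp
      rw [← h3]
      refine Finset.sum_le_sum_of_subset_of_nonneg ?_ fun _ _ _ =>
        indicator_nonneg (fun _ _ => zero_le_one) _
      intro k hk
      obtain ⟨j, hj, rfl⟩ := Finset.mem_image.1 hk
      have hj := Finset.mem_range.1 hj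
      exact Finset.mem_range.2 (Nat.mul_lt_mul_of_pos_left hj hp)
    change 1 / (2 * (p : ℝ)) < birkhoffAvg f V (p * (n + 1)) x
    have hn : (0 : ℝ) < n + 1 := by positivity
    unfold birkhoffAvg
    push_cast
    rw [lt_div_iff₀ (by positivity)]
    refine lt_of_lt_of_le ?_ h2
    field_simp
    norm_num

section Attractors

variable {X : Type*} [TopologicalSpace X]

theorem isClosed_omegaLim (f : X → X) (x : X) : IsClosed (omegaLim f x) :=
  isClosed_iInter fun _ => isClosed_closure

theorem omegaLim_inter_nonempty {f : X → X} {x : X} {K : Set X} (hK : IsCompact K)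
    (hKc : IsClosed K) (h : ∀ n, ∃ m, n ≤ m ∧ f^[m] x ∈ K) : (omegaLim f x ∩ K).Nonempty := by
  have hne : (⋂ n : ℕ, closure {y | ∃ m, n ≤ m ∧ f^[m] x = y} ∩ K).Nonempty := by
    refine IsCompact.nonempty_iInter_of_sequence_nonempty_isCompact_isClosed _ ?_ ?_ ?_ ?_
    · intro n
      refine inter_subset_inter_left _ (closure_mono ?_)
      rintro y ⟨m, hm, rfl⟩
      exact ⟨m, by omega, rfl⟩
    · intro n
      obtain ⟨m, hm, hmK⟩ := h n
      exact ⟨_, subset_closure ⟨m, hm, rfl⟩, hmK⟩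
    · exact hK.inter_left isClosed_closure
    · exact fun n => isClosed_closure.inter hKc
  rwa [← iInter_inter] at hne

theorem omegaLim_subset_of_isClosed {f : X → X} {x : X} {K : Set X} (hK : IsClosed K) (N : ℕ)
    (h : ∀ n, N ≤ n → f^[n] x ∈ K) : omegaLim f x ⊆ K := by
  refine (iInter_subset _ N).trans (closure_minimal ?_ hK)
  rintro y ⟨m, hm, rfl⟩
  exact h m hm

theorem exists_iterate_mem_of_mem_omegaLim {f : X → X} {x z : X} (hz : z ∈ omegaLim f x)
    {U : Set X} (hU : IsOpen U) (hzU : z ∈ U) (n : ℕ) : ∃ m, n ≤ m ∧ f^[m] x ∈ U := by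
  obtain ⟨_, hy, m, hm, rfl⟩ := mem_closure_iff.1 (mem_iInter.1 hz n) U hU hzU
  exact ⟨m, hm, hy⟩

theorem omegaLim_subset_nonWandering (f : X → X) (x : X) : omegaLim f x ⊆ nonWandering f := by
  intro z hz U hU hzU
  obtain ⟨m, -, hm⟩ := exists_iterate_mem_of_mem_omegaLim hz hU hzU 0
  obtain ⟨k, hk, hkU⟩ := exists_iterate_mem_of_mem_omegaLim hz hU hzU (m + 1)
  refine ⟨k - m, by omega, f^[k] x, ⟨f^[m] x, hm, ?_⟩, hkU⟩
  rw [← Function.iterate_add_apply, Nat.sub_add_cancel (by omega)]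

theorem isClosed_nonWandering (f : X → X) : IsClosed (nonWandering f) := by
  rw [← closure_subset_iff_isClosed]
  intro x hx U hU hxU
  obtain ⟨y, hyU, hy⟩ := mem_closure_iff.1 hx U hU hxU
  exact hy U hU hyU

theorem milnorAttr_subset_nonWandering [MeasurableSpace X] (lam : Measure X) (f : X → X) :
    milnorAttr lam f ⊆ nonWandering f :=
  sInter_subset_of_mem
    ⟨isClosed_nonWandering f, ae_of_all _ fun x => omegaLim_subset_nonWandering f x⟩

theorem ae_omegaLim_subset_milnorAttr [SecondCountableTopology X] [MeasurableSpace X]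
    (lam : Measure X) (f : X → X) : ∀ᵐ x ∂lam, omegaLim f x ⊆ milnorAttr lam f := by
  obtain ⟨T, hTc, hTS, hT⟩ := TopologicalSpace.isOpen_sUnion_countable
    (compl '' {A : Set X | IsClosed A ∧ ∀ᵐ x ∂lam, omegaLim f x ⊆ A})
    (by rintro _ ⟨A, hA, rfl⟩; exact hA.1.isOpen_compl)
  have hae : ∀ᵐ x ∂lam, ∀ t ∈ T, omegaLim f x ⊆ tᶜ := by
    rw [ae_ball_iff hTc]
    intro t ht
    obtain ⟨A, hA, rfl⟩ := hTS ht
    simpa using hA.2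
  filter_upwards [hae] with x hx
  have : milnorAttr lam f = (⋃₀ T)ᶜ := by
    rw [hT, ← compl_sInter, compl_compl, milnorAttr]
  rw [this]
  intro z hz hzT
  obtain ⟨t, ht, hzt⟩ := hzT
  exact hx t ht hz hzt

variable [MeasurableSpace X]

theorem statAttr_subset_milnorAttr [CompactSpace X] [T2Space X] [SecondCountableTopology X]
    (lam : Measure X) (f : X → X) : statAttr lam f ⊆ milnorAttr lam f := by
  intro z hz
  by_contra hzA
  have hcl : IsClosed (milnorAttr lam f) := isClosed_sInter fun A hA => hA.1
  obtain ⟨U, hU, hzU, hUA⟩ := exists_open_between_and_isCompact_closure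
    (isCompact_singleton (x := z)) hcl.isOpen_compl (by simpa using hzA)
  refine hz.2 ⟨U, ⟨hU, ?_⟩, hzU rfl⟩
  filter_upwards [ae_omegaLim_subset_milnorAttr lam f] with x hx
  have : ∃ N, ∀ n, N ≤ n → f^[n] x ∉ U := by
    by_contra! hcon
    obtain ⟨w, hw1, hw2⟩ := omegaLim_inter_nonempty (f := f) (x := x) hUA.2 isClosed_closure
      fun n => (hcon n).imp fun m hm => ⟨hm.1, subset_closure hm.2⟩
    exact hUA.1 hw2 (hx hw1)
  obtain ⟨N, hN⟩ := this
  exact tendsto_birkhoffAvg_zero hN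

theorem physAttr_subset_statAttr [BorelSpace X] (lam : Measure X) [IsFiniteMeasure lam]
    {f : X → X} (hf : Measurable f) : physAttr lam f ⊆ statAttr lam f := by
  refine sdiff_subset_sdiff_right (sUnion_subset_sUnion ?_)
  rintro U ⟨hU, hae⟩
  refine ⟨hU, ?_⟩
  rintro ⟨ε, hε, δ, hδ, k, hk, h⟩
  have h1 : TendstoInMeasure lam (fun n => birkhoffAvg f U n) atTop (fun _ => 0) :=
    tendstoInMeasure_of_tendsto_ae
      (fun n => (measurable_birkhoffAvg hf hU.measurableSet n).aestronglyMeasurable) hae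
  rw [tendstoInMeasure_iff_norm] at h1
  have h2 := (h1 ε hε).comp hk
  have h3 : ENNReal.ofReal δ ≤ 0 := by
    refine ge_of_tendsto' h2 fun n => (h n).le.trans (measure_mono fun x hx => ?_)
    change ε ≤ ‖birkhoffAvg f U (k n) x - 0‖
    rw [sub_zero]
    exact hx.le.trans (le_abs_self _)
  simp at h3
  linarith

end Attractors

instance : (volume : Measure I01).IsOpenPosMeasure := by
  refine ⟨fun U hU hne => ?_⟩
  obtain ⟨a, b, hab, h⟩ := hU.exists_Ioo_subset hne
  have hpos : (volume : Measure I01) (Ioo a b) ≠ 0 := by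
    rw [unitInterval.volume_Ioo]
    simpa using hab
  exact fun h0 => hpos (measure_mono_null h h0)

theorem TrapsIn.essential {f : C(I01, I01)} {U : Set I01} (hf : f ∈ TrapsIn U) :
    Essential (volume : Measure I01) ⇑f U := by
  obtain ⟨p, hp, K, -, ⟨x, hx⟩, hKU, h⟩ := hf
  exact (essential_of_mapsTo hp (h.mono_left interior_subset)
    (isOpen_interior.measure_pos _ ⟨_, h hx⟩)).mono (interior_subset.trans hKU)

theorem TrapsIn.milnorAttr_inter_nonempty {f : C(I01, I01)} {U : Set I01} (hf : f ∈ TrapsIn U) :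
    (milnorAttr (volume : Measure I01) ⇑f ∩ U).Nonempty := by
  obtain ⟨p, hp, K, hK, ⟨x, hx⟩, hKU, h⟩ := hf
  have hpos : (volume : Measure I01) (interior K) ≠ 0 :=
    (isOpen_interior.measure_pos _ ⟨_, h hx⟩).ne'
  obtain ⟨y, hy, hyA⟩ := Measure.exists_mem_of_measure_ne_zero_of_ae hpos
    (ae_restrict_of_ae (ae_omegaLim_subset_milnorAttr (volume : Measure I01) ⇑f))
  obtain ⟨w, hw1, hw2⟩ := omegaLim_inter_nonempty (f := ⇑f) (x := y) hK.isCompact hK fun n =>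
    ⟨p * n, Nat.le_mul_of_pos_left n hp,
      iterate_mul_mem (h.mono_right interior_subset) (interior_subset hy) n⟩
  exact ⟨w, hyA hw1, hKU hw2⟩

theorem exists_nonWandering_mem {f : C(I01, I01)} {C L : Set I01} (hC : IsClosed C)
    (hne : C.Nonempty) (hLC : L ⊆ C) (h : MapsTo f C L) : ∃ z ∈ nonWandering ⇑f, z ∈ L := by
  obtain ⟨y, hy⟩ := hne
  have hit : ∀ n, (⇑f)^[n] y ∈ C := fun n => (h.mono_right hLC).iterate n hy
  have hfC : IsClosed (f '' C) := (hC.isCompact.image f.continuous).isClosed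
  obtain ⟨z, hz, -⟩ := omegaLim_inter_nonempty (f := ⇑f) (x := y) isCompact_univ isClosed_univ
    fun n => ⟨n, le_rfl, mem_univ _⟩
  refine ⟨z, omegaLim_subset_nonWandering _ _ hz, h.image_subset
    (omegaLim_subset_of_isClosed hfC 1 (fun n hn => ?_) hz)⟩
  obtain ⟨k, rfl⟩ : ∃ k, n = k + 1 := ⟨n - 1, by omega⟩
  rw [Function.iterate_succ_apply']
  exact mem_image_of_mem _ (hit k)

/-- `f` has finitely many disjoint closed trapping sets of measure at most `ε`, which together
contain, outside of the sets they are mapped into, all of the interval up to measure `ε`. -/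
def Shreds (ε : ℝ) : Set C(I01, I01) :=
  {f | ∃ (M : ℕ) (C L : Fin M → Set I01) (D : Set I01),
    (∀ m, IsClosed (C m)) ∧ (∀ m, IsOpen (L m)) ∧ IsOpen D ∧
    (∀ i j, i ≠ j → Disjoint (C i) (C j)) ∧ (∀ m, L m ⊆ C m) ∧ (D ⊆ ⋃ m, C m) ∧
    (∀ m, Disjoint D (L m)) ∧ (∀ m, volume (C m) ≤ ENNReal.ofReal ε) ∧
    volume Dᶜ ≤ ENNReal.ofReal ε ∧ ∀ m, MapsTo f (C m) (L m)}

theorem isOpen_shreds (ε : ℝ) : IsOpen (Shreds ε) := by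
  rw [isOpen_iff_mem_nhds]
  rintro f ⟨M, C, L, D, hC, hL, hD, h1, h2, h3, h4, h5, h6, hf⟩
  have ho : IsOpen (⋂ m, {g : C(I01, I01) | MapsTo g (C m) (L m)}) :=
    isOpen_iInter_of_finite fun m =>
      ContinuousMap.isOpen_setOfPred_mapsTo (hC m).isCompact (hL m)
  refine mem_of_superset (ho.mem_nhds (mem_iInter.2 hf)) fun g hg => ?_
  exact ⟨M, C, L, D, hC, hL, hD, h1, h2, h3, h4, h5, h6, fun m => mem_iInter.1 hg m⟩

theorem volume_nonWandering_le {f : C(I01, I01)} {ε : ℝ} (hf : f ∈ Shreds ε) :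
    volume (nonWandering ⇑f) ≤ ENNReal.ofReal ε := by
  obtain ⟨M, C, L, D, hC, hL, hD, h1, h2, h3, h4, h5, h6, hf⟩ := hf
  refine (measure_mono ?_).trans h6
  intro x hx hxD
  obtain ⟨n, hn, _, ⟨y, hy, rfl⟩, hz⟩ := hx D hD hxD
  obtain ⟨m, hm⟩ := mem_iUnion.1 (h3 hy)
  obtain ⟨k, rfl⟩ : ∃ k, n = k + 1 := ⟨n - 1, by omega⟩
  rw [Function.iterate_succ_apply'] at hz
  exact (Set.disjoint_left.1 (h4 m)) hz
    (hf m (((hf m).mono_right (h2 m)).iterate k hm))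

theorem volume_nonWandering_eq_zero {f : C(I01, I01)}
    (hf : ∀ n : ℕ, f ∈ Shreds (1 / ((n : ℝ) + 4))) : volume (nonWandering ⇑f) = 0 := by
  have h : Tendsto (fun n : ℕ => ENNReal.ofReal (1 / ((n : ℝ) + 4))) atTop (𝓝 0) := by
    rw [← ENNReal.ofReal_zero]
    refine ENNReal.tendsto_ofReal ?_
    exact tendsto_const_nhds.div_atTop
      (tendsto_atTop_add_const_right _ _ tendsto_natCast_atTop_atTop)
  exact le_antisymm (ge_of_tendsto' h fun n => volume_nonWandering_le (hf n)) bot_le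

theorem volume_empiricalConv_le {f : C(I01, I01)} {ε : ℝ} (hf : f ∈ Shreds ε)
    (μ : Measure I01) : volume {x | empiricalConv ⇑f μ x} ≤ 2 * ENNReal.ofReal ε := by
  obtain ⟨M, C, L, D, hC, hL, hD, h1, h2, h3, h4, h5, h6, hf⟩ := hf
  set B := {x | empiricalConv ⇑f μ x} with hB
  have huniq : ∀ i j : Fin M, i ≠ j → ∀ x ∈ B ∩ C i, ∀ y ∈ B ∩ C j, False := by
    intro i j hij x hx y hy
    obtain ⟨φ, h0, h1, -⟩ := exists_continuous_zero_one_of_isClosed (hC i) (hC j) (h1 i j hij)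
    have hxC : ∀ n, (⇑f)^[n] x ∈ C i := fun n => ((hf i).mono_right (h2 i)).iterate n hx.2
    have hyC : ∀ n, (⇑f)^[n] y ∈ C j := fun n => ((hf j).mono_right (h2 j)).iterate n hy.2
    have e1 : Tendsto (fun n : ℕ => (∑ k ∈ Finset.range n, φ ((⇑f)^[k] x)) / n) atTop (𝓝 0) := by
      have : ∀ n : ℕ, (∑ k ∈ Finset.range n, φ ((⇑f)^[k] x)) / n = 0 := by
        intro n
        rw [Finset.sum_eq_zero fun k _ => h0 (hxC k), zero_div]
      simp only [this, tendsto_const_nhds]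
    have e2 : Tendsto (fun n : ℕ => (∑ k ∈ Finset.range n, φ ((⇑f)^[k] y)) / n) atTop (𝓝 1) := by
      refine tendsto_const_nhds.congr' ?_
      filter_upwards [eventually_gt_atTop 0] with n hn
      have hn' : (n : ℝ) ≠ 0 := by positivity
      rw [Finset.sum_congr rfl fun k _ => h1 (hyC k)]
      simp [hn']
    exact zero_ne_one ((tendsto_nhds_unique e1 (hx.1 φ)).trans
      (tendsto_nhds_unique e2 (hy.1 φ)).symm)
  have hBD : volume (B ∩ D) ≤ ENNReal.ofReal ε := by
    rcases (B ∩ D).eq_empty_or_nonempty with he | ⟨x, hx⟩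
    · simp [he]
    · obtain ⟨i, hi⟩ := mem_iUnion.1 (h3 hx.2)
      refine (measure_mono ?_).trans (h5 i)
      intro y hy
      obtain ⟨j, hj⟩ := mem_iUnion.1 (h3 hy.2)
      by_cases hij : i = j
      · rwa [hij]
      · exact (huniq i j hij x ⟨hx.1, hi⟩ y ⟨hy.1, hj⟩).elim
  calc volume B ≤ volume ((B ∩ D) ∪ Dᶜ) := measure_mono fun x hx => by
        by_cases h : x ∈ D
        · exact Or.inl ⟨hx, h⟩
        · exact Or.inr h
    _ ≤ volume (B ∩ D) + volume Dᶜ := measure_union_le _ _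
    _ ≤ ENNReal.ofReal ε + ENNReal.ofReal ε := add_le_add hBD h6
    _ = 2 * ENNReal.ofReal ε := (two_mul _).symm

theorem volume_empiricalConv_eq_zero {f : C(I01, I01)}
    (hf : ∀ n : ℕ, f ∈ Shreds (1 / ((n : ℝ) + 4))) (μ : Measure I01) :
    volume {x | empiricalConv ⇑f μ x} = 0 := by
  have h : Tendsto (fun n : ℕ => 2 * ENNReal.ofReal (1 / ((n : ℝ) + 4))) atTop (𝓝 (2 * 0)) := by
    refine ENNReal.Tendsto.const_mul ?_ (Or.inr (by simp))
    rw [← ENNReal.ofReal_zero]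
    refine ENNReal.tendsto_ofReal ?_
    exact tendsto_const_nhds.div_atTop
      (tendsto_atTop_add_const_right _ _ tendsto_natCast_atTop_atTop)
  rw [mul_zero] at h
  exact le_antisymm (ge_of_tendsto' h fun n => volume_empiricalConv_le (hf n) μ) bot_le

theorem not_exists_dense_orbit_nonWandering {f : C(I01, I01)} (hf : f ∈ Shreds (1 / 4)) :
    ¬ ∃ x ∈ nonWandering ⇑f, closure {y | ∃ n : ℕ, (⇑f)^[n] x = y} = nonWandering ⇑f := by
  rintro ⟨x, -, hx⟩
  obtain ⟨M, C, L, D, hC, hL, hD, h1, h2, h3, h4, h5, h6, hf⟩ := hf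
  have hlt : ∀ s t : Set I01, volume s ≤ ENNReal.ofReal (1 / 4) →
      volume t ≤ ENNReal.ofReal (1 / 4) → s ∪ t ≠ univ := by
    intro s t hs ht he
    have h := measure_union_le (μ := (volume : Measure I01)) s t
    rw [he, measure_univ] at h
    have h' := h.trans (add_le_add hs ht)
    rw [← ENNReal.ofReal_add (by norm_num) (by norm_num), ← ENNReal.ofReal_one,
      ENNReal.ofReal_le_ofReal_iff (by norm_num)] at h'
    norm_num at h'
  obtain ⟨y, hy⟩ := (ne_univ_iff_exists_notMem _).1 (hlt ∅ Dᶜ (by simp) h6)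
  simp only [empty_union, mem_compl_iff, not_not] at hy
  obtain ⟨i, hi⟩ := mem_iUnion.1 (h3 hy)
  obtain ⟨z, hz⟩ := (ne_univ_iff_exists_notMem _).1 (hlt (C i) Dᶜ (h5 i) h6)
  simp only [mem_union, mem_compl_iff, not_or, not_not] at hz
  obtain ⟨j, hj⟩ := mem_iUnion.1 (h3 hz.2)
  have hij : i ≠ j := by
    rintro rfl
    exact hz.1 hj
  have hvisit : ∀ m, (C m).Nonempty → ∃ n, ∀ k, n ≤ k → (⇑f)^[k] x ∈ C m := by
    intro m hm
    obtain ⟨w, hw, hwL⟩ := exists_nonWandering_mem (hC m) hm (h2 m) (hf m)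
    rw [← hx] at hw
    obtain ⟨_, hv, n, rfl⟩ := mem_closure_iff.1 hw _ (hL m) hwL
    refine ⟨n, fun k hk => ?_⟩
    obtain ⟨l, rfl⟩ := Nat.exists_eq_add_of_le' hk
    rw [Function.iterate_add_apply]
    exact ((hf m).mono_right (h2 m)).iterate l (h2 m hv)
  obtain ⟨a, ha⟩ := hvisit i ⟨y, hi⟩
  obtain ⟨b, hb⟩ := hvisit j ⟨z, hj⟩
  exact Set.disjoint_left.1 (h1 i j hij) (ha (max a b) (le_max_left _ _))
    (hb (max a b) (le_max_right _ _))

/-- Maps whose graph crosses the diagonal upwards. -/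
def CrossesUp : Set C(I01, I01) :=
  {f | ∃ a b : I01, a < b ∧ f a < a ∧ b < f b}

theorem isOpen_crossesUp : IsOpen CrossesUp := by
  rw [isOpen_iff_mem_nhds]
  rintro f ⟨a, b, hab, ha, hb⟩
  have ho : IsOpen {g : C(I01, I01) | g a < a ∧ b < g b} :=
    (isOpen_lt (continuous_eval_const a) continuous_const).and
      (isOpen_lt continuous_const (continuous_eval_const b))
  exact mem_of_superset (ho.mem_nhds ⟨ha, hb⟩) fun g hg => ⟨a, b, hab, hg⟩

theorem exists_fixedPoint (f : C(I01, I01)) : ∃ p, f p = p := by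
  have h := intermediate_value_univ₂ (a := (0 : I01)) (b := (1 : I01)) continuous_id f.continuous
    (f 0).2.1 (f 1).2.2
  obtain ⟨p, hp⟩ := h
  exact ⟨p, hp.symm⟩

theorem dense_crossesUp : Dense CrossesUp := by
  intro f
  rw [Metric.mem_closure_iff]
  intro ε hε
  obtain ⟨p, hp⟩ := exists_fixedPoint f
  obtain ⟨δ, hδ, hf⟩ := Metric.continuous_iff.1 f.continuous p (ε / 4) (by positivity)
  obtain ⟨c, d, hcd, hsub⟩ := (Metric.isOpen_ball (x := p) (ε := min δ (ε / 4))).exists_Ioo_subset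
    ⟨p, Metric.mem_ball_self (by positivity)⟩
  obtain ⟨a', hca, had⟩ := exists_between hcd
  obtain ⟨a, haa, had⟩ := exists_between had
  obtain ⟨b, hab, hbd⟩ := exists_between had
  obtain ⟨b', hbb, hbd⟩ := exists_between hbd
  have hclose : ∀ x ∈ Ioo c d, ∀ y ∈ Ioo c d, dist (f x) y ≤ ε / 2 := by
    intro x hx y hy
    have h1 := hf x (lt_of_lt_of_le (hsub hx) (min_le_left _ _))
    have h2 := lt_of_lt_of_le (Metric.mem_ball.1 (hsub hy)) (min_le_right _ _)
    rw [hp] at h1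
    linarith [dist_triangle_right (f x) y p]
  obtain ⟨g, hgd, hg⟩ := exists_perturbation_eq_const f (ε := ε / 2)
    (fun i : Bool => {if i then b else a}) (fun _ => isClosed_singleton)
    (by
      intro i j hij
      rw [disjoint_singleton]
      cases i <;> cases j <;> simp_all [hab.ne, hab.ne'])
    (fun i => if i then b' else a')
    (by
      rintro i x rfl
      cases i
      · exact hclose _ ⟨hca.trans haa, had⟩ _ ⟨hca, haa.trans had⟩
      · exact hclose _ ⟨(hca.trans haa).trans hab, hbb.trans hbd⟩ _
          ⟨((hca.trans haa).trans hab).trans hbb, hbd⟩)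
    (by positivity)
  refine ⟨g, ⟨a, b, hab, ?_, ?_⟩, ?_⟩
  · rw [hg false a rfl]
    exact haa
  · rw [hg true b rfl]
    exact hbb
  · rw [dist_comm]
    linarith

theorem not_lyapunovStable_nonWandering {f : C(I01, I01)} (hf : f ∈ CrossesUp)
    (h0 : volume (nonWandering ⇑f) = 0) : ¬ LyapunovStable ⇑f (nonWandering ⇑f) := by
  intro hs
  obtain ⟨a, b, hab, ha, hb⟩ := hf
  have hcomp : IsCompact {x | x ∈ Icc a b ∧ f x ≤ x} :=
    (isClosed_Icc.inter (isClosed_le f.continuous continuous_id)).isCompact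
  obtain ⟨q, ⟨⟨haq, hqb⟩, hfq⟩, hmax⟩ := hcomp.exists_isGreatest
    ⟨a, ⟨le_rfl, hab.le⟩, ha.le⟩
  have hqb : q < b := lt_of_le_of_ne hqb (by rintro rfl; exact absurd hfq hb.not_ge)
  have hgt : ∀ x, q < x → x ≤ b → x < f x := by
    intro x hqx hxb
    by_contra! hx
    exact absurd (hmax ⟨⟨haq.trans hqx.le, hxb⟩, hx⟩) hqx.not_ge
  have hfix : f q = q := by
    refine le_antisymm hfq ?_
    have hcl : IsClosed {x : I01 | x ≤ f x} := isClosed_le continuous_id f.continuous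
    have hsub : closure (Ioo q b) ⊆ {x : I01 | x ≤ f x} :=
      closure_minimal (fun x hx => (hgt x hx.1 hx.2.le).le) hcl
    rw [closure_Ioo hqb.ne] at hsub
    exact hsub ⟨le_rfl, hqb.le⟩
  have hqit : ∀ n, (⇑f)^[n] q = q := fun n => Function.iterate_fixed hfix n
  have hq : q ∈ nonWandering ⇑f := fun U _ hqU => ⟨1, le_rfl, q, ⟨q, hqU, hfix⟩, hqU⟩
  obtain ⟨w, hw, hwΩ⟩ : ∃ w ∈ Ioo q b, w ∉ nonWandering ⇑f := by
    by_contra! hcon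
    exact ((isOpen_Ioo.measure_pos volume (nonempty_Ioo.2 hqb)).ne')
      (measure_mono_null hcon h0)
  obtain ⟨V, hV, hΩV, hVU⟩ := hs {w}ᶜ isOpen_compl_singleton (by simpa using hwΩ)
  obtain ⟨u, hqu, hu⟩ := exists_Ico_subset_of_mem_nhds (hV.mem_nhds (hΩV hq)) ⟨b, hqb⟩
  obtain ⟨x, hqx, hxu⟩ := exists_between (lt_min hqu hqb)
  have hlt : ∀ n, (⇑f)^[n] x < w := by
    intro n
    by_contra! hge
    have hIVT := intermediate_value_Icc hqx.le (f.continuous.iterate n).continuousOn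
    obtain ⟨y, hy, hyw⟩ := hIVT ⟨(hqit n).le.trans hw.1.le, hge⟩
    exact hVU y (hu ⟨hy.1, hy.2.trans_lt (hxu.trans_le (min_le_left _ _))⟩) n hyw
  have hgt' : ∀ n, x ≤ (⇑f)^[n] x := by
    intro n
    induction n with
    | zero => exact le_rfl
    | succ n ih =>
      rw [Function.iterate_succ_apply']
      exact ih.trans (hgt _ (hqx.trans_le ih) ((hlt n).trans hw.2).le).le
  have hmono : Monotone fun n => (⇑f)^[n] x := by
    refine monotone_nat_of_le_succ fun n => ?_
    rw [Function.iterate_succ_apply']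
    exact (hgt _ (hqx.trans_le (hgt' n)) ((hlt n).trans hw.2).le).le
  have hlim := tendsto_atTop_ciSup hmono (OrderTop.bddAbove _)
  set l := ⨆ n, (⇑f)^[n] x
  have hfl : f l = l := isFixedPt_of_tendsto_iterate hlim f.continuous.continuousAt
  have hl1 : x ≤ l := ge_of_tendsto' hlim hgt'
  have hl2 : l ≤ w := le_of_tendsto' hlim fun n => (hlt n).le
  exact absurd hfl (hgt l (hqx.trans_le hl1) (hl2.trans hw.2.le)).ne'

theorem volume_preimage_mul_Ioo {n a b : ℝ} (hn : 0 < n) (ha : 0 ≤ a) (hab : a ≤ b)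
    (hb : b ≤ n) : volume ((fun x : I01 => n * (x : ℝ)) ⁻¹' Ioo a b) = ENNReal.ofReal ((b - a) / n) := by
  have h : (fun x : I01 => n * (x : ℝ)) ⁻¹' Ioo a b =
      Ioo (⟨a / n, by positivity, (div_le_one hn).2 (hab.trans hb)⟩ : I01)
        ⟨b / n, div_nonneg (ha.trans hab) hn.le, (div_le_one hn).2 hb⟩ := by
    ext x
    rw [mem_preimage, mem_Ioo, mem_Ioo, ← Subtype.coe_lt_coe, ← Subtype.coe_lt_coe]
    rw [div_lt_iff₀' hn, lt_div_iff₀' hn]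
  rw [h, unitInterval.volume_Ioo, sub_div]

theorem volume_preimage_mul_Icc {n a b : ℝ} (hn : 0 < n) (ha : 0 ≤ a) (hab : a ≤ b)
    (hb : b ≤ n) : volume ((fun x : I01 => n * (x : ℝ)) ⁻¹' Icc a b) = ENNReal.ofReal ((b - a) / n) := by
  have h : (fun x : I01 => n * (x : ℝ)) ⁻¹' Icc a b =
      Icc (⟨a / n, by positivity, (div_le_one hn).2 (hab.trans hb)⟩ : I01)
        ⟨b / n, div_nonneg (ha.trans hab) hn.le, (div_le_one hn).2 hb⟩ := by
    ext x
    rw [mem_preimage, mem_Icc, mem_Icc, ← Subtype.coe_le_coe, ← Subtype.coe_le_coe]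
    rw [div_le_iff₀' hn, le_div_iff₀' hn]
  rw [h, unitInterval.volume_Icc, sub_div]

theorem exists_fin_le_mul_le {N : ℕ} (hN : 0 < N) (y : I01) :
    ∃ j : Fin N, (j : ℝ) ≤ N * y ∧ N * (y : ℝ) ≤ j + 1 := by
  have hN' : (0 : ℝ) < N := by exact_mod_cast hN
  have hy0 : 0 ≤ N * (y : ℝ) := mul_nonneg hN'.le y.2.1
  by_cases h : ⌊N * (y : ℝ)⌋₊ < N
  · exact ⟨⟨_, h⟩, Nat.floor_le hy0, (Nat.lt_floor_add_one _).le⟩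
  · have h1 : (N : ℝ) ≤ N * y := (Nat.le_floor_iff hy0).1 (not_lt.1 h)
    refine ⟨⟨N - 1, by omega⟩, ?_, ?_⟩
    · simp only [Nat.cast_sub (Nat.one_le_iff_ne_zero.2 hN.ne')]
      push_cast
      linarith
    · simp only [Nat.cast_sub (Nat.one_le_iff_ne_zero.2 hN.ne')]
      push_cast
      have := y.2.2
      nlinarith

theorem dense_shreds {ε : ℝ} (hε : 0 < ε) (hε1 : ε < 1) : Dense (Shreds ε) := by
  intro f
  rw [Metric.mem_closure_iff]
  intro δ hδ
  obtain ⟨η, hη, hf⟩ := Metric.uniformContinuous_iff.1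
    (CompactSpace.uniformContinuous_of_continuous f.continuous) (δ / 4) (by positivity)
  obtain ⟨M, hM⟩ := exists_nat_gt (1 / ε)
  obtain ⟨N, hN⟩ := exists_nat_gt (max (1 / η) (4 / δ))
  have hM0 : (0 : ℝ) < M := lt_trans (by positivity) hM
  have hN0 : (0 : ℝ) < N := lt_trans (lt_of_lt_of_le (by positivity) (le_max_left _ _)) hN
  have hNη : 1 / (N : ℝ) < η := (one_div_lt hη hN0).1 ((le_max_left _ _).trans_lt hN)
  have hNδ : 1 / (N : ℝ) < δ / 4 := by
    have h1 : 4 / δ < N := (le_max_right _ _).trans_lt hN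
    rw [div_lt_iff₀ hδ] at h1
    rw [div_lt_iff₀ hN0]
    linarith
  have hMε : 1 / (M : ℝ) < ε := (one_div_lt hε hM0).1 hM
  set n : ℝ := N * M with hn
  have hn0 : 0 < n := by positivity
  set s : ℝ := ε / 4 with hs
  have hs0 : 0 < s := by positivity
  have hs1 : s < 1 / 4 := by linarith
  let k : Fin N × Fin M → ℕ := fun p => finProdFinEquiv p
  have hkr : ∀ p, (k p : ℝ) = p.2 + M * p.1 := by
    intro p
    simp [k]
  have hkn : ∀ p, (k p : ℝ) + 1 ≤ n := by
    intro p
    have h : k p + 1 ≤ N * M := (finProdFinEquiv p).2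
    have h' : ((k p + 1 : ℕ) : ℝ) ≤ (N * M : ℕ) := Nat.cast_le.2 h
    push_cast at h'
    exact h'
  have hkinj : ∀ p q, (k p : ℝ) < k q + 1 → (k q : ℝ) < k p + 1 → p = q := by
    intro p q h1 h2
    have h1' : k p < k q + 1 := by exact_mod_cast h1
    have h2' : k q < k p + 1 := by exact_mod_cast h2
    exact finProdFinEquiv.injective (Fin.ext (by change k p = k q; omega))
  have hk0 : ∀ p, (0 : ℝ) ≤ k p := fun p => Nat.cast_nonneg _
  let K : Fin N × Fin M → Set I01 := fun p => (fun x : I01 => n * (x : ℝ)) ⁻¹' Icc (k p) (k p + 1 - s)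
  let L : Fin N × Fin M → Set I01 := fun p => (fun x : I01 => n * (x : ℝ)) ⁻¹' Ioo (k p) (k p + s)
  let D : Fin N × Fin M → Set I01 := fun p => (fun x : I01 => n * (x : ℝ)) ⁻¹' Ioo (k p + s) (k p + 1 - s)
  have hcont : Continuous fun x : I01 => n * (x : ℝ) := by fun_prop
  have hKc : ∀ p, IsClosed (K p) := fun p => isClosed_Icc.preimage hcont
  have hLo : ∀ p, IsOpen (L p) := fun p => isOpen_Ioo.preimage hcont
  have hDo : ∀ p, IsOpen (D p) := fun p => isOpen_Ioo.preimage hcont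
  have hLK : ∀ p, L p ⊆ K p := fun p x hx => ⟨hx.1.le, by linarith [hx.2]⟩
  have hDK : ∀ p, D p ⊆ K p := fun p x hx => ⟨by linarith [hx.1], by linarith [hx.2]⟩
  have hKeq : ∀ p q x, x ∈ K p → x ∈ K q → p = q := fun p q x hp hq =>
    hkinj p q (by linarith [hp.1, hq.2]) (by linarith [hp.2, hq.1])
  have hKdisj : ∀ p q, p ≠ q → Disjoint (K p) (K q) := fun p q hpq =>
    Set.disjoint_left.2 fun x hp hq => hpq (hKeq p q x hp hq)
  have hN0' : 0 < N := by exact_mod_cast hN0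
  let e : Fin N → I01 := fun j => ⟨j / N, by positivity, by
    rw [div_le_one hN0]; exact_mod_cast j.2.le⟩
  choose τ hτ1 hτ2 using fun j => exists_fin_le_mul_le hN0' (f (e j))
  let t : Fin N × Fin M → I01 := fun p => ⟨(k (τ p.1, p.2) + s / 2) / n,
    div_nonneg (by linarith [hk0 (τ p.1, p.2)]) hn0.le, by
      rw [div_le_one hn0]
      linarith [hkn (τ p.1, p.2)]⟩
  have htn : ∀ p, n * (t p : ℝ) = k (τ p.1, p.2) + s / 2 := fun p => mul_div_cancel₀ _ hn0.ne'
  have htL : ∀ p, t p ∈ L (τ p.1, p.2) := by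
    intro p
    change (_ : ℝ) < n * (t p : ℝ) ∧ n * (t p : ℝ) < _
    rw [htn]
    constructor <;> linarith
  have hcoarse : ∀ p : Fin N × Fin M, ∀ u : ℝ, (k p : ℝ) ≤ n * u → n * u ≤ k p + 1 →
      (p.1 : ℝ) ≤ N * u ∧ N * u ≤ p.1 + 1 := by
    intro p u h1 h2
    have h3 : (p.2 : ℝ) + 1 ≤ M := by exact_mod_cast p.2.2
    have h4 : (0 : ℝ) ≤ p.2 := Nat.cast_nonneg _
    rw [hkr, hn] at h1 h2
    constructor
    · refine le_of_mul_le_mul_left ?_ hM0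
      linarith
    · refine le_of_mul_le_mul_left ?_ hM0
      linarith
  have habs : ∀ u v : ℝ, |N * u - N * v| ≤ 1 → |u - v| ≤ 1 / N := by
    intro u v h
    rwa [← mul_sub, abs_mul, abs_of_pos hN0, ← le_div_iff₀' hN0] at h
  obtain ⟨g, hgd, hg⟩ := exists_perturbation_eq_const f (ε := δ / 2) K hKc hKdisj t (by
      intro p x hx
      have h1 := hcoarse p x hx.1 (by linarith [hx.2])
      have h2 := hcoarse (τ p.1, p.2) (t p) (by rw [htn]; linarith) (by rw [htn]; linarith)
      have h3 : dist x (e p.1) ≤ 1 / N := by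
        refine habs _ _ ?_
        have : N * (e p.1 : ℝ) = p.1 := mul_div_cancel₀ _ hN0.ne'
        rw [this, abs_le]
        constructor <;> linarith [h1.1, h1.2]
      have h4 : dist (f (e p.1)) (t p) ≤ 1 / N := by
        refine habs _ _ ?_
        rw [abs_le]
        constructor <;> linarith [h2.1, h2.2, hτ1 p.1, hτ2 p.1]
      have h5 := hf (h3.trans_lt hNη)
      linarith [dist_triangle (f x) (f (e p.1)) (t p)]) (by positivity)
  refine ⟨g, ⟨M, fun m => ⋃ j, K (j, m), fun m => ⋃ j, L (j, m), ⋃ p, D p,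
    fun m => isClosed_iUnion_of_finite fun j => hKc _, fun m => isOpen_iUnion fun j => hLo _,
    isOpen_iUnion hDo, ?_, fun m => iUnion_mono fun j => hLK _, ?_, ?_, ?_, ?_, ?_⟩, ?_⟩
  · intro i j hij
    rw [Set.disjoint_left]
    intro x hx hy
    obtain ⟨a, ha⟩ := mem_iUnion.1 hx
    obtain ⟨b, hb⟩ := mem_iUnion.1 hy
    exact hij (congrArg Prod.snd (hKeq _ _ x ha hb))
  · refine iUnion_subset fun p x hx => mem_iUnion.2 ⟨p.2, mem_iUnion.2 ⟨p.1, hDK p hx⟩⟩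
  · intro m
    rw [Set.disjoint_left]
    intro x hx hy
    obtain ⟨p, hp⟩ := mem_iUnion.1 hx
    obtain ⟨j, hj⟩ := mem_iUnion.1 hy
    have h := hKeq _ _ x (hDK p hp) (hLK _ hj)
    subst h
    linarith [hp.1, hj.2]
  · intro m
    calc volume (⋃ j, K (j, m)) ≤ ∑ j : Fin N, volume (K (j, m)) := measure_iUnion_fintype_le _ _
      _ ≤ ∑ _j : Fin N, ENNReal.ofReal (1 / n) := by
        refine Finset.sum_le_sum fun j _ => ?_
        rw [volume_preimage_mul_Icc hn0 (hk0 _) (by linarith) (by linarith [hkn (j, m)])]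
        refine ENNReal.ofReal_le_ofReal ?_
        gcongr
        linarith
      _ = ENNReal.ofReal (1 / M) := by
        rw [← ENNReal.ofReal_sum_of_nonneg fun _ _ => by positivity]
        congr 1
        simp only [Finset.sum_const, Finset.card_univ, Fintype.card_fin, nsmul_eq_mul, hn]
        field_simp
      _ ≤ ENNReal.ofReal ε := ENNReal.ofReal_le_ofReal hMε.le
  · have hvol : volume (⋃ p, D p) = ENNReal.ofReal (1 - 2 * s) := by
      rw [measure_iUnion (fun p q hpq => (hKdisj p q hpq).mono (hDK p) (hDK q))
        fun p => (hDo p).measurableSet, tsum_fintype]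
      have : ∀ p, volume (D p) = ENNReal.ofReal ((1 - 2 * s) / n) := by
        intro p
        rw [volume_preimage_mul_Ioo hn0 (by linarith [hk0 p]) (by linarith) (by linarith [hkn p])]
        congr 2
        ring
      rw [Finset.sum_congr rfl fun p _ => this p, ← ENNReal.ofReal_sum_of_nonneg fun _ _ =>
        div_nonneg (by linarith) hn0.le]
      congr 1
      simp only [Finset.sum_const, Finset.card_univ, Fintype.card_prod, Fintype.card_fin,
        nsmul_eq_mul, hn]
      push_cast
      field_simp
    rw [prob_compl_eq_one_sub (isOpen_iUnion hDo).measurableSet, hvol, ← ENNReal.ofReal_one,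
      ← ENNReal.ofReal_sub _ (by linarith)]
    exact ENNReal.ofReal_le_ofReal (by linarith)
  · intro m x hx
    obtain ⟨j, hj⟩ := mem_iUnion.1 hx
    rw [hg _ x hj]
    exact mem_iUnion.2 ⟨_, htL (j, m)⟩
  · rw [dist_comm]
    linarith

theorem union_interior_compl_mem_residual {X : Type*} [TopologicalSpace X] {s : Set X}
    (hs : IsOpen s) : s ∪ interior sᶜ ∈ residual X := by
  refine residual_of_dense_open (hs.union isOpen_interior) ?_
  rw [dense_iff_closure_eq, closure_union, interior_compl, eq_univ_iff_forall]
  intro x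
  by_cases hx : x ∈ closure s
  · exact Or.inl hx
  · exact Or.inr (subset_closure hx)

/-- The Milnor attractor of `g` stays close to that of `f` as long as `f` and `g` have traps in the
same members of a fine finite cover. -/
theorem hausdorffDist_milnorAttr_lt {f : C(I01, I01)} {B : Set (Set I01)}
    (hB : TopologicalSpace.IsTopologicalBasis B)
    (hf : ∀ U ∈ B, f ∈ TrapsIn U ∪ interior (TrapsIn U)ᶜ) {ε : ℝ} (hε : 0 < ε) :
    ∃ δ > (0:ℝ), ∀ g : C(I01, I01), dist g f < δ →
        Metric.hausdorffDist (milnorAttr (volume : Measure I01) ⇑g)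
          (milnorAttr (volume : Measure I01) ⇑f) < ε := by
  have hcov : ∀ x : I01, ∃ U ∈ B, x ∈ U ∧ U ⊆ Metric.ball x (ε / 4) := fun x =>
    hB.exists_subset_of_mem_open (Metric.mem_ball_self (by positivity)) Metric.isOpen_ball
  choose U hUB hxU hU using hcov
  obtain ⟨T, hT⟩ := isCompact_univ.elim_finite_subcover U (fun x => hB.isOpen (hUB x))
    fun x _ => mem_iUnion.2 ⟨x, hxU x⟩
  have hdist : ∀ c, ∀ x ∈ U c, ∀ y ∈ U c, dist x y ≤ ε / 2 := by
    intro c x hx y hy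
    have h1 := Metric.mem_ball.1 (hU c hx)
    have h2 := Metric.mem_ball.1 (hU c hy)
    linarith [dist_triangle_right x y c]
  have hev : ∀ᶠ g in 𝓝 f, ∀ c ∈ T, (f ∈ TrapsIn (U c) ∧ g ∈ TrapsIn (U c)) ∨
      (f ∈ interior (TrapsIn (U c))ᶜ ∧ g ∈ interior (TrapsIn (U c))ᶜ) := by
    rw [Filter.eventually_all_finset]
    intro c _
    rcases hf (U c) (hUB c) with h | h
    · filter_upwards [(isOpen_trapsIn (U c)).mem_nhds h] with g hg using Or.inl ⟨h, hg⟩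
    · filter_upwards [isOpen_interior.mem_nhds h] with g hg using Or.inr ⟨h, hg⟩
  obtain ⟨δ, hδ, hball⟩ := Metric.eventually_nhds_iff.1 hev
  refine ⟨δ, hδ, fun g hg => ?_⟩
  have hnear : ∀ g₁ g₂ : C(I01, I01), (∀ c ∈ T, g₁ ∈ interior (TrapsIn (U c))ᶜ ∨
      g₂ ∈ TrapsIn (U c)) → ∀ x ∈ milnorAttr (volume : Measure I01) ⇑g₁,
      ∃ y ∈ milnorAttr (volume : Measure I01) ⇑g₂, dist x y ≤ ε / 2 := by
    intro g₁ g₂ h x hx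
    obtain ⟨c, hc, hxc⟩ := mem_iUnion₂.1 (hT (mem_univ x))
    rcases h c hc with h | h
    · exact (Set.disjoint_left.1 (disjoint_nonWandering_of_mem_interior_compl
        (hB.isOpen (hUB c)) h) hxc (milnorAttr_subset_nonWandering _ _ hx)).elim
    · obtain ⟨y, hy, hyc⟩ := TrapsIn.milnorAttr_inter_nonempty h
      exact ⟨y, hy, hdist c x hxc y hyc⟩
  refine lt_of_le_of_lt (Metric.hausdorffDist_le_of_mem_dist (half_pos hε).le ?_ ?_)
    (half_lt_self hε)
  · exact hnear g f fun c hc => (hball hg c hc).symm.imp And.right And.left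
  · exact hnear f g fun c hc => (hball hg c hc).symm.imp And.left And.right

theorem nonWandering_subset_physAttr {f : C(I01, I01)} {B : Set (Set I01)}
    (hB : TopologicalSpace.IsTopologicalBasis B)
    (hf : ∀ U ∈ B, f ∈ TrapsIn U ∪ interior (TrapsIn U)ᶜ) :
    nonWandering ⇑f ⊆ physAttr (volume : Measure I01) ⇑f := by
  refine fun x hx => ⟨mem_univ x, ?_⟩
  rintro ⟨W, ⟨hW, hWe⟩, hxW⟩
  obtain ⟨U, hUB, hxU, hUW⟩ := hB.exists_subset_of_mem_open hxW hW
  rcases hf U hUB with h | h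
  · exact hWe ((TrapsIn.essential h).mono hUW)
  · exact Set.disjoint_left.1
      (disjoint_nonWandering_of_mem_interior_compl (hB.isOpen hUB) h) hxU hx

/-- on a residual set of maps, the common attractor `A = Ω(f)` is robust in
the Hausdorff metric, not Lyapunov stable, has no dense orbit, and `f` has no Palis
attractor. -/
theorem stmt1 :
    ∃ R ∈ residual C(I01, I01), ∀ f ∈ R,
      (milnorAttr (volume : Measure I01) ⇑f = nonWandering ⇑f ∧
       statAttr (volume : Measure I01) ⇑f = nonWandering ⇑f ∧
       physAttr (volume : Measure I01) ⇑f = nonWandering ⇑f) ∧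
      -- (i) robustness with respect to the Hausdorff metric
      (∀ ε > (0:ℝ), ∃ δ > (0:ℝ), ∀ g : C(I01, I01), dist g f < δ →
        Metric.hausdorffDist (milnorAttr (volume : Measure I01) ⇑g)
          (milnorAttr (volume : Measure I01) ⇑f) < ε) ∧
      -- (ii) not Lyapunov stable
      ¬ LyapunovStable ⇑f (nonWandering ⇑f) ∧
      -- (iii) no dense orbit
      (¬ ∃ x ∈ nonWandering ⇑f,
        closure {y | ∃ n : ℕ, (⇑f)^[n] x = y} = nonWandering ⇑f) ∧
      -- (iv) no Palis attractor
      (∀ A : Set I01, ¬ IsPalisAttractor (volume : Measure I01) ⇑f A) := by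
  let B := TopologicalSpace.countableBasis I01
  have hB : TopologicalSpace.IsTopologicalBasis B := TopologicalSpace.isBasis_countableBasis I01
  refine ⟨(⋂ U ∈ B, (TrapsIn U ∪ interior (TrapsIn U)ᶜ)) ∩
    ((⋂ n : ℕ, Shreds (1 / ((n : ℝ) + 4))) ∩ CrossesUp), ?_, ?_⟩
  · refine inter_mem ?_ (inter_mem ?_ ?_)
    · exact (countable_bInter_mem (TopologicalSpace.countable_countableBasis I01)).2 fun U _ =>
        union_interior_compl_mem_residual (isOpen_trapsIn U)
    · refine countable_iInter_mem.2 fun n => residual_of_dense_open (isOpen_shreds _)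
        (dense_shreds (by positivity) ?_)
      rw [div_lt_one (by positivity)]
      have : (0 : ℝ) ≤ n := n.cast_nonneg
      linarith
    · exact residual_of_dense_open isOpen_crossesUp dense_crossesUp
  · rintro f ⟨hf, hs, hc⟩
    have hf : ∀ U ∈ B, f ∈ TrapsIn U ∪ interior (TrapsIn U)ᶜ := mem_iInter₂.1 hf
    have hs := mem_iInter.1 hs
    have h1 := physAttr_subset_statAttr (volume : Measure I01) f.continuous.measurable
    have h2 := statAttr_subset_milnorAttr (volume : Measure I01) ⇑f
    have h3 := milnorAttr_subset_nonWandering (volume : Measure I01) ⇑f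
    have h4 := nonWandering_subset_physAttr hB hf
    refine ⟨⟨h3.antisymm (h4.trans (h1.trans h2)), (h2.trans h3).antisymm (h4.trans h1),
      (h1.trans (h2.trans h3)).antisymm h4⟩, fun ε hε => hausdorffDist_milnorAttr_lt hB hf hε,
      not_lyapunovStable_nonWandering hc (volume_nonWandering_eq_zero hs),
      not_exists_dense_orbit_nonWandering (by simpa using hs 0), ?_⟩
    rintro A ⟨-, -, μ, -, -, -, hμ⟩
    exact hμ.ne' (volume_empiricalConv_eq_zero hs μ)
end
end

section
/- There exists a residual set G ⊆ C([0,1]) such that for every g ∈ G and every nonempty open set U ⊆ [0,1] with g(closure(U)) ⊆ U, the compact invariant set Λ = ⋂_{n≥0} g^n(closure(U)) is not chain transitive. In particular, for every g ∈ G the non-wandering set Ω(g) is not a quasi-attractor of g. -/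
open MeasureTheory Set Filter Topology

noncomputable section

/-- Chain transitivity of a compact invariant set `Λ`: any two points of `Λ` are joined
by ε-chains inside `Λ` for every `ε > 0`. -/
def ChainTransitive (g : I01 → I01) (L : Set I01) : Prop :=
  ∀ x ∈ L, ∀ y ∈ L, ∀ ε > (0:ℝ), ∃ m : ℕ, 1 ≤ m ∧ ∃ z : ℕ → I01,
    z 0 = x ∧ z m = y ∧ (∀ i ≤ m, z i ∈ L) ∧
    ∀ i < m, dist (g (z i)) (z (i + 1)) < ε

/-- A quasi-attractor: a chain transitive compact invariant set which is the intersection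
of a decreasing sequence of attracting regions. -/
def IsQuasiAttractor (g : I01 → I01) (L : Set I01) : Prop :=
  IsCompact L ∧ g '' L = L ∧ ChainTransitive g L ∧
    ∃ U : ℕ → Set I01, (∀ n, IsOpen (U n)) ∧ (∀ n, U (n + 1) ⊆ U n) ∧
      (∀ n, g '' closure (U n) ⊆ interior (U n)) ∧
      L = ⋂ n, ⋂ kk, (g^[kk]) '' U n

section Dynamics

variable {X : Type*}

theorem iterate_mem_of_mapsTo_closure [TopologicalSpace X] {f : X → X} {U : Set X}
    (hU : f '' closure U ⊆ U) {x : X} (hx : x ∈ U) (n : ℕ) : f^[n] x ∈ U := by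
  have h : MapsTo f U U := fun y hy => hU ⟨y, subset_closure hy, rfl⟩
  exact h.iterate n hx

/-- Cluster points of an orbit are visited twice, so in particular they are non-wandering. -/
theorem exists_lt_iterate_mem_of_mapClusterPt [TopologicalSpace X] {f : X → X} {x y : X}
    (hx : MapClusterPt x atTop fun n => f^[n] y) {U : Set X} (hU : U ∈ 𝓝 x) :
    ∃ n m, n < m ∧ f^[n] y ∈ U ∧ f^[m] y ∈ U := by
  have h := mapClusterPt_iff_frequently.1 hx U hU
  obtain ⟨n, -, hn⟩ := frequently_atTop.1 h 0
  obtain ⟨m, hm, hmU⟩ := frequently_atTop.1 h (n + 1)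
  exact ⟨n, m, hm, hn, hmU⟩

theorem mem_nonWandering_of_mapClusterPt [TopologicalSpace X] {f : X → X} {x y : X}
    (hx : MapClusterPt x atTop fun n => f^[n] y) : x ∈ nonWandering f := by
  intro U hU hxU
  obtain ⟨n, m, hnm, hn, hm⟩ := exists_lt_iterate_mem_of_mapClusterPt hx (hU.mem_nhds hxU)
  refine ⟨m - n, by omega, f^[m] y, ⟨f^[n] y, hn, ?_⟩, hm⟩
  rw [← Function.iterate_add_apply, Nat.sub_add_cancel hnm.le]

theorem mem_image_iterate_of_mapClusterPt [TopologicalSpace X] [CompactSpace X] [T2Space X]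
    {f : X → X} (hf : Continuous f) {U : Set X} (hU : f '' closure U ⊆ U) {x y : X} (hy : y ∈ U)
    (hx : MapClusterPt x atTop fun n => f^[n] y) (n : ℕ) : x ∈ f^[n] '' closure U := by
  have hcl : IsClosed (f^[n] '' closure U) :=
    (isClosed_closure.isCompact.image (hf.iterate n)).isClosed
  refine hcl.mem_of_mapClusterPt hx (eventually_atTop.2 ⟨n, fun m hm => ?_⟩)
  refine ⟨f^[m - n] y, subset_closure (iterate_mem_of_mapsTo_closure hU hy _), ?_⟩
  rw [← Function.iterate_add_apply, Nat.add_sub_cancel' hm]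

/-- A trapping region contains a non-wandering point, which can moreover be chosen in the maximal
invariant set of any larger trapping region. -/
theorem exists_mem_nonWandering_of_trapping [TopologicalSpace X] [CompactSpace X] [T2Space X]
    {f : X → X} (hf : Continuous f) {W : Set X} (hne : W.Nonempty) (hW : f '' closure W ⊆ W) :
    ∃ x ∈ W, x ∈ nonWandering f ∧
      ∀ U, W ⊆ U → f '' closure U ⊆ U → x ∈ ⋂ n : ℕ, f^[n] '' closure U := by
  obtain ⟨y, hy⟩ := hne
  obtain ⟨x, -, hx⟩ := isCompact_univ.exists_mapClusterPt (f := atTop)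
    (u := fun n : ℕ => f^[n] y) (by simp)
  refine ⟨x, hW ?_, mem_nonWandering_of_mapClusterPt hx, fun U hWU hU =>
    mem_iInter.2 (mem_image_iterate_of_mapClusterPt hf hU (hWU hy) hx)⟩
  simpa using mem_image_iterate_of_mapClusterPt hf hW hy hx 1

end Dynamics

/-- A chain transitive set cannot meet two disjoint trapping regions. -/
theorem not_chainTransitive_of_disjoint_trapping {g : I01 → I01} (hg : Continuous g)
    {L W₁ W₂ : Set I01} (hW₁ : IsOpen W₁) (hd : Disjoint W₁ W₂) (h₁ : g '' closure W₁ ⊆ W₁)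
    (hL₁ : (L ∩ W₁).Nonempty) (hL₂ : (L ∩ W₂).Nonempty) : ¬ ChainTransitive g L := by
  intro h
  obtain ⟨x, hxL, hx⟩ := hL₁
  obtain ⟨y, hyL, hy⟩ := hL₂
  obtain ⟨ε, hε, hsub⟩ := (isClosed_closure.isCompact.image hg).exists_thickening_subset_open hW₁ h₁
  obtain ⟨m, -, z, rfl, rfl, -, hz⟩ := h x hxL y hyL ε hε
  have key : ∀ i ≤ m, z i ∈ W₁ := by
    intro i
    induction i with
    | zero => exact fun _ => hx
    | succ i ih =>
      intro hi
      refine hsub (Metric.mem_thickening_iff.2 ⟨g (z i), ⟨z i, subset_closure (ih (by omega)), rfl⟩, ?_⟩)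
      rw [dist_comm]
      exact hz i hi
  exact hd.le_bot ⟨key m le_rfl, hy⟩

/-- Interpolation at finitely many points by a continuous function constant near each of them. -/
theorem exists_continuousMap_eventually_eq {X : Type*} [TopologicalSpace X] [T1Space X]
    [NormalSpace X] (s : Finset X) (v : X → ℝ) :
    ∃ h : C(X, ℝ), ∀ c ∈ s, ∀ᶠ x in 𝓝 c, h x = v c := by
  classical
  induction s using Finset.induction_on with
  | empty => exact ⟨0, by simp⟩
  | insert c s hc ih =>
    obtain ⟨h, hh⟩ := ih
    obtain ⟨u, hu0, hu1, -⟩ := exists_continuous_zero_one_of_isClosed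
      s.finite_toSet.isClosed (isClosed_singleton (x := c)) (by simpa using hc)
    let t : C(X, ℝ) := ⟨fun x => min 1 (max 0 (3 * u x - 1)), by fun_prop⟩
    refine ⟨h + t * (ContinuousMap.const X (v c) - h), fun d hd => ?_⟩
    rcases Finset.mem_insert.1 hd with rfl | hd
    · have hud : u d = 1 := hu1 rfl
      filter_upwards [u.continuous.continuousAt.eventually (lt_mem_nhds (a := 2 / 3)
        (by rw [hud]; norm_num))] with x hx
      have : t x = 1 := min_eq_left (le_max_of_le_right (by linarith))
      simp [this]
    · have hud : u d = 0 := hu0 hd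
      filter_upwards [hh d hd, u.continuous.continuousAt.eventually (gt_mem_nhds (a := 1 / 3)
        (by rw [hud]; norm_num))] with x hhx hx
      have : t x = 0 := by
        change min 1 (max 0 (3 * u x - 1)) = 0
        rw [max_eq_left (by linarith)]
        norm_num
      simp [this, hhx]

/-- A small perturbation of `g` taking prescribed values near finitely many points. -/
theorem exists_dist_le_eventually_eq (g : C(I01, I01)) (s : Finset I01) (σ : I01 → I01) {ε : ℝ}
    (hε : 0 < ε) (hσ : ∀ c ∈ s, dist (g c) (σ c) < ε) :
    ∃ f : C(I01, I01), dist f g ≤ ε ∧ ∀ c ∈ s, ∀ᶠ x in 𝓝 c, f x = σ c := by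
  obtain ⟨h, hh⟩ := exists_continuousMap_eventually_eq s fun c => (σ c : ℝ)
  let φ : I01 → ℝ := fun x => max (max 0 (g x - ε)) (min (min 1 (g x + ε)) (h x))
  have hφ : ∀ x, φ x ∈ Set.Icc (0 : ℝ) 1 := fun x =>
    ⟨le_max_of_le_left (le_max_left _ _), max_le (max_le zero_le_one (by linarith [(g x).2.2]))
      (min_le_of_left_le (min_le_left _ _))⟩
  refine ⟨⟨fun x => ⟨φ x, hφ x⟩, by fun_prop⟩, (ContinuousMap.dist_le hε.le).2 fun x => ?_,
    fun c hc => ?_⟩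
  · rw [Subtype.dist_eq, Real.dist_eq, abs_le]
    have h1 : (g x : ℝ) - ε ≤ φ x := le_max_of_le_left (le_max_right _ _)
    have h2 : φ x ≤ g x + ε := max_le (max_le (by linarith [(g x).2.1]) (by linarith))
      (min_le_of_left_le (min_le_right _ _))
    change -ε ≤ φ x - g x ∧ φ x - g x ≤ ε
    constructor <;> linarith
  · have hcont : Continuous fun x => dist (g x) (σ c) := by fun_prop
    filter_upwards [hh c hc, hcont.continuousAt.eventually (gt_mem_nhds (hσ c hc))] with x hx hd
    rw [Subtype.dist_eq, Real.dist_eq, abs_lt] at hd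
    apply Subtype.ext
    change φ x = σ c
    have h3 := (σ c).2.1
    have h4 := (σ c).2.2
    change max (max 0 ((g x : ℝ) - ε)) (min (min 1 (g x + ε)) (h x)) = σ c
    rw [hx, min_eq_right (le_min h4 (by linarith)), max_eq_right (max_le h3 (by linarith))]

/-- The maps having two disjoint nonempty trapping regions inside `V`. -/
def splitMaps (V : Set I01) : Set C(I01, I01) :=
  {g | ∃ W₁ W₂ : Set I01, (W₁.Nonempty ∧ IsOpen W₁ ∧ W₁ ⊆ V) ∧
    (W₂.Nonempty ∧ IsOpen W₂ ∧ W₂ ⊆ V) ∧ Disjoint W₁ W₂ ∧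
    g '' closure W₁ ⊆ W₁ ∧ g '' closure W₂ ⊆ W₂}

theorem isOpen_setOf_trapping {W : Set I01} (hW : IsOpen W) :
    IsOpen {g : C(I01, I01) | g '' closure W ⊆ W} := by
  simpa only [← mapsTo_iff_image_subset] using
    ContinuousMap.isOpen_setOfPred_mapsTo (isClosed_closure (s := W)).isCompact hW

theorem isOpen_splitMaps (V : Set I01) : IsOpen (splitMaps V) := by
  rw [isOpen_iff_mem_nhds]
  rintro g ⟨W₁, W₂, h₁, h₂, hd, t₁, t₂⟩
  filter_upwards [(isOpen_setOf_trapping h₁.2.1).mem_nhds t₁,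
    (isOpen_setOf_trapping h₂.2.1).mem_nhds t₂] with f hf₁ hf₂
  exact ⟨W₁, W₂, h₁, h₂, hd, hf₁, hf₂⟩

/-- A map which is locally constant near two disjoint finite invariant sets has disjoint trapping
regions around them. -/
theorem mem_splitMaps_of_eventually_mem {V : Set I01} (hV : IsOpen V) (f : C(I01, I01))
    {A B : Finset I01} (hA : A.Nonempty) (hB : B.Nonempty) (hAB : Disjoint A B)
    (hAV : (A : Set I01) ⊆ V) (hBV : (B : Set I01) ⊆ V)
    (hfA : ∀ c ∈ A, ∀ᶠ x in 𝓝 c, f x ∈ A) (hfB : ∀ c ∈ B, ∀ᶠ x in 𝓝 c, f x ∈ B) :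
    f ∈ splitMaps V := by
  have key : ∀ C : Finset I01, (C : Set I01) ⊆ V → (∀ c ∈ C, ∀ᶠ x in 𝓝 c, f x ∈ C) →
      ∃ W, IsOpen W ∧ (C : Set I01) ⊆ W ∧ W ⊆ V ∧ ∀ x ∈ closure W, f x ∈ C := by
    intro C hCV hC
    obtain ⟨W, hWo, hCW, hW⟩ := normal_exists_closure_subset C.finite_toSet.isClosed
      (hV.inter (isOpen_interior (s := {x | f x ∈ C})))
      (fun c hc => ⟨hCV hc, mem_interior_iff_mem_nhds.2 (hC c hc)⟩)
    exact ⟨W, hWo, hCW, fun x hx => (hW (subset_closure hx)).1,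
      fun x hx =>
        (interior_subset (s := {x | f x ∈ C}) (hW hx).2 : x ∈ {x | f x ∈ C})⟩
  obtain ⟨W₁, ho₁, hA₁, hV₁, h₁⟩ := key A hAV hfA
  obtain ⟨W₂, ho₂, hB₂, hV₂, h₂⟩ := key B hBV hfB
  refine ⟨W₁, W₂, ⟨hA.to_set.mono hA₁, ho₁, hV₁⟩, ⟨hB.to_set.mono hB₂, ho₂, hV₂⟩, ?_, ?_, ?_⟩
  · exact Set.disjoint_left.2 fun x hx₁ hx₂ => Finset.disjoint_left.1 hAB
      (h₁ x (subset_closure hx₁)) (h₂ x (subset_closure hx₂))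
  · exact image_subset_iff.2 fun x hx => hA₁ (h₁ x hx)
  · exact image_subset_iff.2 fun x hx => hB₂ (h₂ x hx)

/-- A trapping region contains a finite set which is invariant under a map `σ` that is
close to `g` on it. -/
theorem exists_finset_pseudo_invariant (g : C(I01, I01)) {V : Set I01} (hne : V.Nonempty)
    (hg : g '' closure V ⊆ V) {ε : ℝ} (hε : 0 < ε) :
    ∃ (A : Finset I01) (σ : I01 → I01), A.Nonempty ∧ (A : Set I01) ⊆ V ∧
      (∀ c ∈ A, σ c ∈ A) ∧ ∀ c ∈ A, dist (g c) (σ c) < ε := by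
  classical
  obtain ⟨y, hy⟩ := hne
  obtain ⟨x, -, hx⟩ := isCompact_univ.exists_mapClusterPt (f := atTop)
    (u := fun n : ℕ => g^[n] y) (by simp)
  obtain ⟨n, m, hnm, hn, hm⟩ := exists_lt_iterate_mem_of_mapClusterPt hx
    (Metric.ball_mem_nhds x (half_pos hε))
  refine ⟨(Finset.Ico n m).image fun i => g^[i] y,
    fun c => if c = g^[m - 1] y then g^[n] y else g c, ?_, ?_, ?_, ?_⟩
  · exact (Finset.nonempty_Ico.2 hnm).image _
  · intro c hc
    obtain ⟨i, -, rfl⟩ := Finset.mem_image.1 (Finset.mem_coe.1 hc)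
    exact iterate_mem_of_mapsTo_closure hg hy i
  · intro c hc
    obtain ⟨i, hi, rfl⟩ := Finset.mem_image.1 hc
    rw [Finset.mem_Ico] at hi
    refine Finset.mem_image.2 ?_
    dsimp only
    split_ifs with h
    · exact ⟨n, Finset.mem_Ico.2 ⟨le_rfl, hnm⟩, rfl⟩
    · have : i ≠ m - 1 := fun e => h (by rw [e])
      exact ⟨i + 1, Finset.mem_Ico.2 ⟨by omega, by omega⟩, Function.iterate_succ_apply' _ _ _⟩
  · intro c _
    dsimp only
    split_ifs with h
    · rw [h, ← Function.iterate_succ_apply' g, Nat.succ_eq_add_one, Nat.sub_add_cancel (by omega)]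
      linarith [dist_triangle_right (g^[m] y) (g^[n] y) x, Metric.mem_ball.1 hm,
        Metric.mem_ball.1 hn]
    · simpa using hε

/-- A finite set in a perfect space has an injective copy, disjoint from it, whose points lie in
prescribed neighbourhoods. -/
theorem exists_injOn_disjoint_copy {X : Type*} [TopologicalSpace X] [T2Space X]
    [∀ x : X, NeBot (𝓝[≠] x)] (A : Finset X) {p : X → X → Prop} (hp : ∀ c ∈ A, ∀ᶠ x in 𝓝 c, p c x) :
    ∃ β : X → X, InjOn β A ∧ ∀ c ∈ A, β c ∉ A ∧ p c (β c) := by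
  classical
  obtain ⟨U, hU, hd⟩ := A.finite_toSet.t2_separation
  have hex : ∀ c, ∃ b, c ∈ A → b ≠ c ∧ b ∈ U c ∧ p c b := by
    intro c
    by_cases hc : c ∈ A
    · have h : ∀ᶠ x in 𝓝[≠] c, x ≠ c ∧ x ∈ U c ∧ p c x := by
        filter_upwards [self_mem_nhdsWithin, mem_nhdsWithin_of_mem_nhds ((hU c).2.mem_nhds (hU c).1),
          mem_nhdsWithin_of_mem_nhds (hp c hc)] with x h1 h2 h3
        exact ⟨h1, h2, h3⟩
      obtain ⟨b, hb⟩ := h.exists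
      exact ⟨b, fun _ => hb⟩
    · exact ⟨c, fun h => absurd h hc⟩
  choose β hβ using hex
  refine ⟨β, fun c hc d hd' hcd => ?_, fun c hc => ⟨fun h => ?_, (hβ c hc).2.2⟩⟩
  · by_contra hne
    exact Set.disjoint_left.1 (hd hc hd' hne) (hβ c hc).2.1 (hcd ▸ (hβ d hd').2.1)
  · exact Set.disjoint_left.1 (hd hc h (hβ c hc).1.symm) (hβ c hc).2.1 (hU _).1

theorem mem_closure_splitMaps {g : C(I01, I01)} {V : Set I01} (hV : IsOpen V) (hne : V.Nonempty)
    (hg : g '' closure V ⊆ V) : g ∈ closure (splitMaps V) := by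
  classical
  refine Metric.mem_closure_iff.2 fun ε hε => ?_
  have hε' : 0 < ε / 6 := by positivity
  obtain ⟨A, σ, hA, hAV, hσA, hσ⟩ := exists_finset_pseudo_invariant g hne hg hε'
  obtain ⟨β, hβ, hβA⟩ := exists_injOn_disjoint_copy A
    (p := fun c x => x ∈ V ∧ dist x c < ε / 6 ∧ dist (g x) (g c) < ε / 6) fun c hc => by
      filter_upwards [hV.mem_nhds (hAV hc), Metric.ball_mem_nhds c hε',
        g.continuous.continuousAt.eventually (Metric.ball_mem_nhds (g c) hε')] with x h1 h2 h3
      exact ⟨h1, h2, h3⟩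
  let τ : I01 → I01 := fun x => if x ∈ A then σ x else β (σ (Function.invFunOn β A x))
  have hτA : ∀ c ∈ A, τ c = σ c := fun c hc => if_pos hc
  have hτB : ∀ c ∈ A, τ (β c) = β (σ c) := fun c hc => by
    simp only [τ, if_neg (hβA c hc).1, hβ.leftInvOn_invFunOn hc]
  obtain ⟨f, hfg, hf⟩ := exists_dist_le_eventually_eq g (A ∪ A.image β) τ (half_pos hε) (by
    intro c hc
    rcases Finset.mem_union.1 hc with hc | hc
    · rw [hτA c hc]
      linarith [hσ c hc]
    · obtain ⟨a, ha, rfl⟩ := Finset.mem_image.1 hc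
      rw [hτB a ha]
      obtain ⟨-, -, -, h1⟩ := hβA a ha
      obtain ⟨-, -, h2, -⟩ := hβA (σ a) (hσA a ha)
      rw [dist_comm] at h2
      linarith [hσ a ha, dist_triangle4 (g (β a)) (g a) (σ a) (β (σ a))])
  refine ⟨f, mem_splitMaps_of_eventually_mem hV f hA (hA.image β) ?_ hAV ?_ ?_ ?_, ?_⟩
  · refine Finset.disjoint_right.2 fun b hb => ?_
    obtain ⟨c, hc, rfl⟩ := Finset.mem_image.1 hb
    exact (hβA c hc).1
  · intro b hb
    obtain ⟨c, hc, rfl⟩ := Finset.mem_image.1 (Finset.mem_coe.1 hb)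
    exact (hβA c hc).2.1
  · intro c hc
    filter_upwards [hf c (Finset.mem_union_left _ hc)] with x hx
    rw [hx, hτA c hc]
    exact hσA c hc
  · intro b hb
    filter_upwards [hf b (Finset.mem_union_right _ hb)] with x hx
    obtain ⟨c, hc, rfl⟩ := Finset.mem_image.1 hb
    rw [hx, hτB c hc]
    exact Finset.mem_image_of_mem _ (hσA c hc)
  · rw [dist_comm]
    linarith

theorem IsOpen.compl_frontier_mem_residual {X : Type*} [TopologicalSpace X] {s : Set X}
    (hs : IsOpen s) : (frontier s)ᶜ ∈ residual X := by
  refine residual_of_dense_open isClosed_frontier.isOpen_compl ?_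
  rw [← interior_eq_empty_iff_dense_compl, ← frontier_compl]
  exact interior_frontier hs.isClosed_compl

/-- In a second countable space, countably many open sets suffice to separate compact sets from
the complements of their open neighbourhoods. -/
theorem exists_countable_isOpen_between (X : Type*) [TopologicalSpace X]
    [SecondCountableTopology X] :
    ∃ 𝒱 : Set (Set X), 𝒱.Countable ∧ (∀ V ∈ 𝒱, IsOpen V) ∧
      ∀ K U : Set X, IsCompact K → IsOpen U → K ⊆ U → ∃ V ∈ 𝒱, K ⊆ V ∧ V ⊆ U := by
  obtain ⟨B, hBc, -, hB⟩ := TopologicalSpace.exists_countable_basis X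
  refine ⟨sUnion '' {S | S.Finite ∧ S ⊆ B}, (countable_ofPred_finite_subset hBc).image _, ?_, ?_⟩
  · rintro _ ⟨S, ⟨-, hS⟩, rfl⟩
    exact isOpen_sUnion fun s hs => hB.isOpen (hS hs)
  · intro K U hK hU hKU
    rw [hB.open_eq_sUnion' hU, sUnion_eq_biUnion] at hKU
    obtain ⟨S, hSB, hSf, hKS⟩ := hK.elim_finite_subcover_image (fun s hs => hB.isOpen hs.1) hKU
    exact ⟨⋃₀ S, ⟨S, ⟨hSf, fun s hs => (hSB hs).1⟩, rfl⟩, by rwa [sUnion_eq_biUnion],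
      sUnion_subset fun s hs => (hSB hs).2⟩

/-- for a residual set of maps `g`, no attracting region gives rise to a
chain transitive invariant set; in particular `Ω(g)` is not a quasi-attractor. -/
theorem stmt12 :
    ∃ G ∈ residual C(I01, I01), ∀ g ∈ G,
      (∀ U : Set I01, U.Nonempty → IsOpen U → ⇑g '' closure U ⊆ U →
        ¬ ChainTransitive ⇑g (⋂ n : ℕ, (⇑g)^[n] '' closure U)) ∧
      ¬ IsQuasiAttractor ⇑g (nonWandering ⇑g) := by
  obtain ⟨𝒱, h𝒱c, h𝒱o, h𝒱⟩ := exists_countable_isOpen_between I01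
  refine ⟨⋂ V ∈ 𝒱, (frontier (splitMaps V))ᶜ, (countable_bInter_mem h𝒱c).2 fun V _ =>
    (isOpen_splitMaps V).compl_frontier_mem_residual, fun g hg => ?_⟩
  have hsplit : ∀ U : Set I01, U.Nonempty → IsOpen U → g '' closure U ⊆ U → g ∈ splitMaps U := by
    intro U hne hU hgU
    obtain ⟨V, hV, hKV, hVU⟩ :=
      h𝒱 _ U (isClosed_closure.isCompact.image g.continuous) hU hgU
    have hcl := mem_closure_splitMaps (h𝒱o V hV) ((hne.closure.image g).mono hKV)
      ((image_mono (closure_mono hVU)).trans hKV)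
    have hmem : g ∈ splitMaps V := by
      by_contra hnot
      exact mem_iInter₂.1 hg V hV
        ⟨hcl, fun h => hnot (interior_subset h)⟩
    obtain ⟨W₁, W₂, h₁, h₂, h⟩ := hmem
    exact ⟨W₁, W₂, ⟨h₁.1, h₁.2.1, h₁.2.2.trans hVU⟩, ⟨h₂.1, h₂.2.1, h₂.2.2.trans hVU⟩, h⟩
  constructor
  · intro U hne hU hgU
    obtain ⟨W₁, W₂, ⟨hn₁, ho₁, hs₁⟩, ⟨hn₂, -, hs₂⟩, hd, t₁, t₂⟩ := hsplit U hne hU hgU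
    obtain ⟨x, hx, -, hxU⟩ := exists_mem_nonWandering_of_trapping g.continuous hn₁ t₁
    obtain ⟨y, hy, -, hyU⟩ := exists_mem_nonWandering_of_trapping g.continuous hn₂ t₂
    exact not_chainTransitive_of_disjoint_trapping g.continuous ho₁ hd t₁
      ⟨x, hxU U hs₁ hgU, hx⟩ ⟨y, hyU U hs₂ hgU, hy⟩
  · rintro ⟨-, -, hct, -⟩
    obtain ⟨W₁, W₂, ⟨hn₁, ho₁, -⟩, ⟨hn₂, -, -⟩, hd, t₁, t₂⟩ :=
      hsplit univ univ_nonempty isOpen_univ (subset_univ _)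
    obtain ⟨x, hx, hxΩ, -⟩ := exists_mem_nonWandering_of_trapping g.continuous hn₁ t₁
    obtain ⟨y, hy, hyΩ, -⟩ := exists_mem_nonWandering_of_trapping g.continuous hn₂ t₂
    exact not_chainTransitive_of_disjoint_trapping g.continuous ho₁ hd t₁
      ⟨x, hxΩ, hx⟩ ⟨y, hyΩ, hy⟩ hct
end
end
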